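/- arXiv:2411.12267 — 3 statements merged into one kernel-verified Lean document; each statement's English description precedes it below -/
import Mathlib

section
/- Let ε > 0 and let u : ℝ → ℝ be twice differentiable. Then for every x ∈ ℝ, ε·(d/dx)(−ε·u'(x) + (1/2)·tanh(x/(2ε))·u(x)) + (1/2)·tanh(x/(2ε))·(−ε·u'(x) + (1/2)·tanh(x/(2ε))·u(x)) = −ε²·u''(x) + (1/4)·u(x). That is, with a^ε = ε∂x + (1/2)tanh(x/(2ε)) and (a^ε)* = −ε∂x + (1/2)tanh(x/(2ε)), one has a^ε (a^ε)* = −ε²∂x² + 1/4, an operator with constant potential. -/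
open Real

theorem Real.hasDerivAt_tanh_one_sub_sq (x : ℝ) :
    HasDerivAt Real.tanh (1 - Real.tanh x ^ 2) x := by
  have hc : Real.cosh x ≠ 0 := (Real.cosh_pos x).ne'
  have h := (Real.hasDerivAt_sinh x).div (Real.hasDerivAt_cosh x) hc
  have hfun : Real.tanh = Real.sinh / Real.cosh := funext Real.tanh_eq_sinh_div_cosh
  rw [← hfun] at h
  refine h.congr_deriv ?_
  rw [Real.tanh_eq_sinh_div_cosh]
  field_simp

theorem stmt_7 (ε : ℝ) (hε : 0 < ε) (u : ℝ → ℝ)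
    (hu : Differentiable ℝ u) (hu' : Differentiable ℝ (deriv u)) :
    ∀ x : ℝ,
      ε * deriv (fun y => -ε * deriv u y + (1 / 2) * Real.tanh (y / (2 * ε)) * u y) x
        + (1 / 2) * Real.tanh (x / (2 * ε)) *
            (-ε * deriv u x + (1 / 2) * Real.tanh (x / (2 * ε)) * u x) =
      -(ε ^ 2) * deriv (deriv u) x + (1 / 4) * u x := by
  intro x
  have hT : HasDerivAt (fun y => Real.tanh (y / (2 * ε)))
      ((1 - Real.tanh (x / (2 * ε)) ^ 2) * (1 / (2 * ε))) x :=
    HasDerivAt.comp (h₂ := Real.tanh) (h := fun y => y / (2 * ε)) x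
      (Real.hasDerivAt_tanh_one_sub_sq (x / (2 * ε))) ((hasDerivAt_id' x).div_const (2 * ε))
  have h : HasDerivAt (fun y => -ε * deriv u y + (1 / 2) * Real.tanh (y / (2 * ε)) * u y) _ x :=
    ((hu' x).hasDerivAt.const_mul (-ε)).add ((hT.const_mul (1 / 2)).mul (hu x).hasDerivAt)
  rw [h.deriv]
  field_simp
  ring
end

section
/- Let L > 0. There exists C > 0 such that for every ε ∈ (0, 1], every integer k ≥ 1, and every real λ with λ − 1/(4ε) ≥ k²·π²ε/(4L²), the following holds: set s = √(ελ − 1/4); if s·cos(sL/ε) = (1/2)·tanh(L/(2ε))·sin(sL/ε), then the function ψ(x) = cosh(x/(2ε))·(−s·cos(s·x/ε) + (1/2)·tanh(x/(2ε))·sin(s·x/ε)) satisfies ψ(L) = ψ(−L) = 0 and (∫_{−L}^{L} ψ(x)² dx)^{1/2} ≤ (C/(k·√ε))·|ε·ψ'(−L)|. -/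
open Real

/-- The (unnormalised) adjoint eigenfunction with frequency `s`. -/
noncomputable def adjointMode (ε s x : ℝ) : ℝ :=
  cosh (x / (2 * ε)) *
    (-s * cos (s * x / ε) + (1 / 2) * tanh (x / (2 * ε)) * sin (s * x / ε))

theorem adjointMode_eq_sinh (ε s x : ℝ) :
    adjointMode ε s x =
      -s * (cosh (x / (2 * ε)) * cos (s * x / ε))
        + (1 / 2) * (sinh (x / (2 * ε)) * sin (s * x / ε)) := by
  have := (cosh_pos (x / (2 * ε))).ne'
  rw [adjointMode, tanh_eq_sinh_div_cosh]
  field_simp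

theorem adjointMode_neg (ε s x : ℝ) : adjointMode ε s (-x) = adjointMode ε s x := by
  simp [adjointMode, neg_div]

theorem hasDerivAt_adjointMode {ε : ℝ} (hε : ε ≠ 0) (s x : ℝ) :
    HasDerivAt (adjointMode ε s)
      ((s ^ 2 + 1 / 4) / ε * (cosh (x / (2 * ε)) * sin (s * x / ε))) x := by
  have hu : HasDerivAt (fun y : ℝ => y / (2 * ε)) (1 / (2 * ε)) x :=
    (hasDerivAt_id x).div_const _
  have hv : HasDerivAt (fun y : ℝ => s * y / ε) (s * 1 / ε) x :=
    ((hasDerivAt_id x).const_mul s).div_const _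
  rw [funext (adjointMode_eq_sinh ε s)]
  refine (((hu.cosh.mul hv.cos).const_mul (-s)).add
    ((hu.sinh.mul hv.sin).const_mul (1 / 2))).congr_deriv ?_
  field_simp
  ring

theorem tanh_sq_le_one (x : ℝ) : tanh x ^ 2 ≤ 1 := by
  rw [tanh_eq_sinh_div_cosh, div_pow, div_le_one (by positivity [cosh_pos x])]
  linarith [cosh_sq x]

theorem adjointMode_sq_le (ε s x : ℝ) :
    adjointMode ε s x ^ 2 ≤ (s ^ 2 + 1 / 4) * cosh (x / (2 * ε)) ^ 2 := by
  have hT := tanh_sq_le_one (x / (2 * ε))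
  have hsc := sin_sq_add_cos_sq (s * x / ε)
  rw [adjointMode, mul_pow, mul_comm]
  refine mul_le_mul_of_nonneg_right ?_ (sq_nonneg _)
  generalize tanh (x / (2 * ε)) = t at *
  generalize sin (s * x / ε) = a at *
  generalize cos (s * x / ε) = b at *
  calc (-s * b + 1 / 2 * t * a) ^ 2
      = (s ^ 2 + t ^ 2 / 4) * (a ^ 2 + b ^ 2) - (s * a + t / 2 * b) ^ 2 := by ring
    _ ≤ s ^ 2 + 1 / 4 := by rw [hsc]; linarith [sq_nonneg (s * a + t / 2 * b)]

theorem integral_cosh_sq_le {ε L : ℝ} (hε : 0 < ε) (hL : 0 ≤ L) :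
    ∫ x in (-L)..L, cosh (x / (2 * ε)) ^ 2 ≤ 4 * ε * cosh (L / (2 * ε)) ^ 2 := by
  have hderiv (x : ℝ) : HasDerivAt
      (fun y => y / 2 + ε * (sinh (y / (2 * ε)) * cosh (y / (2 * ε))))
      (cosh (x / (2 * ε)) ^ 2) x := by
    have hu : HasDerivAt (fun y : ℝ => y / (2 * ε)) (1 / (2 * ε)) x :=
      (hasDerivAt_id x).div_const _
    refine (((hasDerivAt_id x).div_const 2).add
      ((hu.sinh.mul hu.cosh).const_mul ε)).congr_deriv ?_
    field_simp
    linarith [cosh_sq (x / (2 * ε))]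
  rw [intervalIntegral.integral_eq_sub_of_hasDerivAt (fun x _ => hderiv x)
    (Continuous.intervalIntegrable (by fun_prop) _ _)]
  have hy : 0 ≤ L / (2 * ε) := by positivity
  simp only [neg_div, sinh_neg, cosh_neg]
  have h1 : L / (2 * ε) ≤ sinh (L / (2 * ε)) := self_le_sinh_iff.2 hy
  have h2 : sinh (L / (2 * ε)) ≤ cosh (L / (2 * ε)) := (sinh_lt_cosh _).le
  have h3 := one_le_cosh (L / (2 * ε))
  have h4 : L / (2 * ε) + sinh (L / (2 * ε)) * cosh (L / (2 * ε))
      ≤ 2 * cosh (L / (2 * ε)) ^ 2 := by nlinarith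
  calc _ = 2 * ε * (L / (2 * ε) + sinh (L / (2 * ε)) * cosh (L / (2 * ε))) := by
        field_simp; ring
    _ ≤ 2 * ε * (2 * cosh (L / (2 * ε)) ^ 2) := by gcongr
    _ = _ := by ring

theorem integral_adjointMode_sq_le {ε L : ℝ} (hε : 0 < ε) (hL : 0 ≤ L) (s : ℝ) :
    ∫ x in (-L)..L, adjointMode ε s x ^ 2
      ≤ (s ^ 2 + 1 / 4) * (4 * ε * cosh (L / (2 * ε)) ^ 2) := by
  have hcont : Continuous (adjointMode ε s) :=
    continuous_iff_continuousAt.2 fun x => (hasDerivAt_adjointMode hε.ne' s x).continuousAt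
  calc ∫ x in (-L)..L, adjointMode ε s x ^ 2
      ≤ ∫ x in (-L)..L, (s ^ 2 + 1 / 4) * cosh (x / (2 * ε)) ^ 2 :=
        intervalIntegral.integral_mono_on (by linarith)
          ((hcont.pow 2).intervalIntegrable _ _)
          (Continuous.intervalIntegrable (by fun_prop) _ _)
          fun x _ => adjointMode_sq_le ε s x
    _ ≤ _ := by
        rw [intervalIntegral.integral_const_mul]
        gcongr
        exact integral_cosh_sq_le hε hL

/-- The Dirichlet condition bounds the boundary derivative from below. -/
theorem le_sq_deriv_adjointMode {ε L s : ℝ} (hε : ε ≠ 0)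
    (hs : s * cos (s * L / ε) = (1 / 2) * tanh (L / (2 * ε)) * sin (s * L / ε)) :
    (s ^ 2 + 1 / 4) * s ^ 2 * cosh (L / (2 * ε)) ^ 2
      ≤ (ε * deriv (adjointMode ε s) (-L)) ^ 2 := by
  have hT := tanh_sq_le_one (L / (2 * ε))
  have hsc := sin_sq_add_cos_sq (s * L / ε)
  have hsin : s ^ 2 ≤ (s ^ 2 + 1 / 4) * sin (s * L / ε) ^ 2 := by
    have h := congrArg (· ^ 2) hs
    simp only [mul_pow] at h
    nlinarith [mul_le_mul_of_nonneg_right hT (sq_nonneg (sin (s * L / ε)))]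
  have hD : ε * deriv (adjointMode ε s) (-L)
      = -((s ^ 2 + 1 / 4) * (cosh (L / (2 * ε)) * sin (s * L / ε))) := by
    rw [(hasDerivAt_adjointMode hε s (-L)).deriv]
    simp only [neg_div, mul_neg, cosh_neg, sin_neg]
    field_simp
  rw [hD]
  calc (s ^ 2 + 1 / 4) * s ^ 2 * cosh (L / (2 * ε)) ^ 2
      ≤ (s ^ 2 + 1 / 4) * ((s ^ 2 + 1 / 4) * sin (s * L / ε) ^ 2)
          * cosh (L / (2 * ε)) ^ 2 := by gcongr
    _ = _ := by ring

theorem stmt_12 (L : ℝ) (hL : 0 < L) :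
    ∃ C : ℝ, 0 < C ∧
      ∀ ε : ℝ, ε ∈ Set.Ioc (0 : ℝ) 1 →
        ∀ k : ℕ, 1 ≤ k →
          ∀ lam : ℝ,
            lam - 1 / (4 * ε) ≥ (k : ℝ) ^ 2 * Real.pi ^ 2 * ε / (4 * L ^ 2) →
            Real.sqrt (ε * lam - 1 / 4) * Real.cos (Real.sqrt (ε * lam - 1 / 4) * L / ε)
                = (1 / 2) * Real.tanh (L / (2 * ε)) *
                    Real.sin (Real.sqrt (ε * lam - 1 / 4) * L / ε) →
            ((fun x => Real.cosh (x / (2 * ε)) *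
                (-(Real.sqrt (ε * lam - 1 / 4)) *
                    Real.cos (Real.sqrt (ε * lam - 1 / 4) * x / ε)
                  + (1 / 2) * Real.tanh (x / (2 * ε)) *
                      Real.sin (Real.sqrt (ε * lam - 1 / 4) * x / ε))) L = 0 ∧
             (fun x => Real.cosh (x / (2 * ε)) *
                (-(Real.sqrt (ε * lam - 1 / 4)) *
                    Real.cos (Real.sqrt (ε * lam - 1 / 4) * x / ε)
                  + (1 / 2) * Real.tanh (x / (2 * ε)) *
                      Real.sin (Real.sqrt (ε * lam - 1 / 4) * x / ε))) (-L) = 0) ∧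
            Real.sqrt (∫ x in (-L)..L,
                (Real.cosh (x / (2 * ε)) *
                  (-(Real.sqrt (ε * lam - 1 / 4)) *
                      Real.cos (Real.sqrt (ε * lam - 1 / 4) * x / ε)
                    + (1 / 2) * Real.tanh (x / (2 * ε)) *
                        Real.sin (Real.sqrt (ε * lam - 1 / 4) * x / ε))) ^ 2)
              ≤ (C / ((k : ℝ) * Real.sqrt ε)) *
                |ε * deriv (fun x => Real.cosh (x / (2 * ε)) *
                  (-(Real.sqrt (ε * lam - 1 / 4)) *
                      Real.cos (Real.sqrt (ε * lam - 1 / 4) * x / ε)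
                    + (1 / 2) * Real.tanh (x / (2 * ε)) *
                        Real.sin (Real.sqrt (ε * lam - 1 / 4) * x / ε))) (-L)| := by
  refine ⟨4 * L / π, by positivity, fun ε hε k hk lam hlam hs => ?_⟩
  have hε0 : 0 < ε := hε.1
  have hk0 : (0 : ℝ) < k := by exact_mod_cast hk
  have hle : (k : ℝ) ^ 2 * π ^ 2 * ε ^ 2 / (4 * L ^ 2) ≤ ε * lam - 1 / 4 := by
    have h := mul_le_mul_of_nonneg_left hlam hε0.le
    calc (k : ℝ) ^ 2 * π ^ 2 * ε ^ 2 / (4 * L ^ 2)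
        = ε * ((k : ℝ) ^ 2 * π ^ 2 * ε / (4 * L ^ 2)) := by ring
      _ ≤ ε * (lam - 1 / (4 * ε)) := h
      _ = ε * lam - 1 / 4 := by field_simp
  rw [← sq_sqrt ((by positivity : (0 : ℝ) ≤ _).trans hle)] at hle
  generalize √(ε * lam - 1 / 4) = s at *
  have hzero : adjointMode ε s L = 0 := by
    rw [adjointMode, neg_mul, hs, neg_add_cancel, mul_zero]
  refine ⟨⟨hzero, (adjointMode_neg ε s L).trans hzero⟩, ?_⟩
  change √(∫ x in (-L)..L, adjointMode ε s x ^ 2)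
    ≤ 4 * L / π / (k * √ε) * |ε * deriv (adjointMode ε s) (-L)|
  refine sqrt_le_iff.2 ⟨by positivity, ?_⟩
  rw [mul_pow, sq_abs]
  calc ∫ x in (-L)..L, adjointMode ε s x ^ 2
      ≤ (s ^ 2 + 1 / 4) * (4 * ε * cosh (L / (2 * ε)) ^ 2) :=
        integral_adjointMode_sq_le hε0 hL.le s
    _ = (4 * L / π / (k * √ε)) ^ 2 * ((s ^ 2 + 1 / 4)
          * ((k : ℝ) ^ 2 * π ^ 2 * ε ^ 2 / (4 * L ^ 2)) * cosh (L / (2 * ε)) ^ 2) := by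
        simp only [div_pow, mul_pow, sq_sqrt hε0.le]
        field_simp
    _ ≤ (4 * L / π / (k * √ε)) ^ 2 * ((s ^ 2 + 1 / 4) * s ^ 2 * cosh (L / (2 * ε)) ^ 2) := by
        gcongr
    _ ≤ _ := by
        gcongr
        exact le_sq_deriv_adjointMode hε0.ne' hs
end

section
/- Let L > 0. For ε ∈ (0, L/4), let λ0(ε) be the unique solution in [0, 1/(4ε)) of the first eigenvalue equation, let μ0(ε) = √(1/4 − ελ0(ε)), and let ψ0^ε(x) = cosh(x/(2ε))·(−μ0(ε)·cosh(μ0(ε)·x/ε) + (1/2)·tanh(x/(2ε))·sinh(μ0(ε)·x/ε)). Then −2ε·(ψ0^ε)'(−L) → 1 as ε → 0⁺, where (ψ0^ε)'(−L) denotes the derivative of ψ0^ε at x = −L. -/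
open Real Filter

theorem tanh_pos_of_pos {x : ℝ} (hx : 0 < x) : 0 < Real.tanh x := by
  rw [Real.tanh_eq_sinh_div_cosh]
  exact div_pos (Real.sinh_pos_iff.2 hx) (Real.cosh_pos x)

theorem one_sub_tanh_le_two_mul_exp (x : ℝ) : 1 - Real.tanh x ≤ 2 * Real.exp (-(2 * x)) := by
  have h1 := Real.exp_pos x
  have h2 := Real.exp_pos (-x)
  have h3 : Real.exp (-(2 * x)) = Real.exp (-x) * Real.exp (-x) := by
    rw [← Real.exp_add]; ring_nf
  have h4 : Real.exp x * Real.exp (-x) = 1 := by rw [← Real.exp_add]; simp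
  rw [Real.tanh_eq_sinh_div_cosh, Real.sinh_eq, Real.cosh_eq, h3,
    div_div_div_cancel_right₀ two_ne_zero, one_sub_div (by positivity), div_le_iff₀ (by positivity)]
  nlinarith [pow_pos h2 3]

theorem le_one_add_mul_tanh (y : ℝ) : y ≤ (1 + y) * Real.tanh y := by
  have h1 := Real.exp_pos y
  have h2 := Real.exp_pos (-y)
  have h4 : Real.exp y * Real.exp (-y) = 1 := by rw [← Real.exp_add]; simp
  have h5 : 2 * y + 1 ≤ Real.exp y * Real.exp y := by
    rw [← Real.exp_add, ← two_mul]; exact Real.add_one_le_exp _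
  have h6 : (2 * y + 1) * Real.exp (-y) ≤ Real.exp y := by
    calc (2 * y + 1) * Real.exp (-y) ≤ (Real.exp y * Real.exp y) * Real.exp (-y) := by gcongr
      _ = Real.exp y := by rw [mul_assoc, h4, mul_one]
  rw [Real.tanh_eq_sinh_div_cosh, Real.sinh_eq, Real.cosh_eq,
    div_div_div_cancel_right₀ two_ne_zero, mul_div_assoc', le_div_iff₀ (by positivity)]
  linarith

theorem tendsto_tanh_atTop_one : Tendsto Real.tanh atTop (nhds 1) := by
  have h : Tendsto (fun x : ℝ => 1 - 2 * Real.exp (-(2 * x))) atTop (nhds 1) := by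
    have : Tendsto (fun x : ℝ => Real.exp (-(2 * x))) atTop (nhds 0) :=
      Real.tendsto_exp_neg_atTop_nhds_zero.comp (tendsto_id.const_mul_atTop two_pos)
    simpa using (this.const_mul 2).const_sub 1
  exact tendsto_of_tendsto_of_tendsto_of_le_of_le h tendsto_const_nhds
    (fun x => by have := one_sub_tanh_le_two_mul_exp x; dsimp only; linarith)
    (fun x => (Real.tanh_lt_one x).le)

/-- The positive root `y` of `y = A tanh A tanh y` is exponentially close to `A`. -/
theorem sub_le_of_eq_mul_tanh_mul_tanh {A y : ℝ} (hA : 0 < A) (hy : 0 < y)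
    (h : y = A * Real.tanh A * Real.tanh y) :
    A - y ≤ 2 * (1 + Real.exp 4) * (A * Real.exp (-(2 * A))) := by
  have hT := Real.tanh_lt_one A
  have hS := Real.tanh_lt_one y
  have hT' := one_sub_tanh_le_two_mul_exp A
  have hS' := one_sub_tanh_le_two_mul_exp y
  have hS0 : 0 < Real.tanh y := tanh_pos_of_pos hy
  have hlow : A * Real.tanh A ≤ 1 + y := by
    refine le_of_mul_le_mul_right ?_ hS0
    rw [← h]
    exact le_one_add_mul_tanh y
  have hexp : A * Real.exp (-(2 * A)) ≤ 1 / 2 := by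
    have h1 : 2 * A ≤ Real.exp (2 * A) := by linarith [Real.add_one_le_exp (2 * A)]
    rw [Real.exp_neg, ← div_eq_mul_inv, div_le_iff₀ (Real.exp_pos _)]
    linarith
  have hyA : A - 2 ≤ y := by nlinarith
  have hexp' : Real.exp (-(2 * y)) ≤ Real.exp 4 * Real.exp (-(2 * A)) := by
    rw [← Real.exp_add]
    exact Real.exp_le_exp.2 (by linarith)
  have h1 : A * (1 - Real.tanh A) ≤ A * (2 * Real.exp (-(2 * A))) := by gcongr
  have h2 : A * Real.tanh A * (1 - Real.tanh y) ≤
      A * 1 * (2 * (Real.exp 4 * Real.exp (-(2 * A)))) := by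
    have : 0 ≤ 1 - Real.tanh y := by linarith
    have : 1 - Real.tanh y ≤ 2 * (Real.exp 4 * Real.exp (-(2 * A))) := by linarith
    gcongr
  linarith

theorem one_sub_sq_tanh_mul_cosh_mul_sinh (A y : ℝ) :
    (1 - (Real.tanh A * Real.tanh y) ^ 2) * Real.cosh A * Real.sinh y =
      Real.tanh y * (Real.cosh A / Real.cosh y)⁻¹ +
        Real.tanh A ^ 2 * Real.tanh y * (Real.cosh A / Real.cosh y) := by
  have hA := (Real.cosh_pos A).ne'
  have hy := (Real.cosh_pos y).ne'
  simp only [Real.tanh_eq_sinh_div_cosh]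
  field_simp
  linear_combination (Real.sinh y * Real.cosh y ^ 2) * Real.cosh_sq A +
    Real.sinh y * Real.sinh A ^ 2 * Real.cosh_sq y

theorem cosh_div_cosh_eq (A y : ℝ) :
    Real.cosh A / Real.cosh y =
      (1 + Real.exp (-(2 * A))) / (Real.exp (-(A - y)) + Real.exp (-(A + y))) := by
  rw [Real.cosh_eq, Real.cosh_eq, div_div_div_cancel_right₀ two_ne_zero,
    div_eq_div_iff (by positivity) (by positivity)]
  simp only [add_mul, mul_add, one_mul, ← Real.exp_add]
  ring_nf

theorem tendsto_cosh_mul_sinh_of_eq_mul_tanh {ι : Type*} {l : Filter ι} {A y : ι → ℝ}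
    (hA : Tendsto A l atTop) (hy : ∀ᶠ i in l, 0 < y i)
    (h : ∀ᶠ i in l, y i = A i * Real.tanh (A i) * Real.tanh (y i)) :
    Tendsto (fun i => (1 - (Real.tanh (A i) * Real.tanh (y i)) ^ 2) * Real.cosh (A i) *
      Real.sinh (y i)) l (nhds 2) := by
  have hd : Tendsto (fun i => A i - y i) l (nhds 0) := by
    have hlim : Tendsto (fun a : ℝ => 2 * (1 + Real.exp 4) * (a * Real.exp (-(2 * a))))
        atTop (nhds 0) := by
      have := ((Real.tendsto_pow_mul_exp_neg_atTop_nhds_zero 1).comp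
        (tendsto_id.const_mul_atTop (two_pos (α := ℝ)))).const_mul (1 + Real.exp 4)
      rw [mul_zero] at this
      refine this.congr fun a => ?_
      simp only [Function.comp_apply, id, pow_one]
      ring
    refine squeeze_zero' ?_ ?_ (hlim.comp hA)
    · filter_upwards [hA.eventually_gt_atTop 0, hy, h] with i hAi hyi hi
      have hT := Real.tanh_lt_one (A i)
      have hS := Real.tanh_lt_one (y i)
      have hS0 := tanh_pos_of_pos hyi
      have : Real.tanh (A i) * Real.tanh (y i) ≤ 1 := by nlinarith
      nlinarith
    · filter_upwards [hA.eventually_gt_atTop 0, hy, h] with i hAi hyi hi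
      exact sub_le_of_eq_mul_tanh_mul_tanh hAi hyi hi
  have hyT : Tendsto y l atTop := by
    refine (hA.atTop_add hd.neg).congr fun i => ?_
    ring
  have hT := tendsto_tanh_atTop_one.comp hA
  have hS := tendsto_tanh_atTop_one.comp hyT
  have hr : Tendsto (fun i => Real.cosh (A i) / Real.cosh (y i)) l (nhds 1) := by
    have h1 := Real.tendsto_exp_neg_atTop_nhds_zero.comp (hA.const_mul_atTop two_pos)
    have h2 := Real.tendsto_exp_neg_atTop_nhds_zero.comp (hA.atTop_add_atTop hyT)
    have h3 := (Real.continuous_exp.tendsto _).comp hd.neg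
    have := (h1.const_add 1).div (h3.add h2) (by simp)
    simp only [neg_zero, Real.exp_zero, add_zero, div_one] at this
    exact this.congr fun i => (cosh_div_cosh_eq _ _).symm
  have := (hS.mul (hr.inv₀ one_ne_zero)).add (((hT.pow 2).mul hS).mul hr)
  norm_num only at this
  exact this.congr fun i => (one_sub_sq_tanh_mul_cosh_mul_sinh _ _).symm

theorem deriv_cosh_mul_first_adjoint_eigenfunction {ε : ℝ} (hε : ε ≠ 0) (m x : ℝ) :
    deriv (fun x => Real.cosh (x / (2 * ε)) *
          (-m * Real.cosh (m * x / ε)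
            + (1 / 2) * Real.tanh (x / (2 * ε)) * Real.sinh (m * x / ε))) x =
      (1 / 4 - m ^ 2) / ε * Real.cosh (x / (2 * ε)) * Real.sinh (m * x / ε) := by
  have hfun : (fun x => Real.cosh (x / (2 * ε)) *
          (-m * Real.cosh (m * x / ε)
            + (1 / 2) * Real.tanh (x / (2 * ε)) * Real.sinh (m * x / ε))) =
      fun x => -m * (Real.cosh (x / (2 * ε)) * Real.cosh (m * x / ε)) +
        (1 / 2) * (Real.sinh (x / (2 * ε)) * Real.sinh (m * x / ε)) := by
    funext x
    have := (Real.cosh_pos (x / (2 * ε))).ne'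
    rw [Real.tanh_eq_sinh_div_cosh]
    field_simp
  have ha : HasDerivAt (fun x : ℝ => x / (2 * ε)) (1 / (2 * ε)) x :=
    (hasDerivAt_id x).div_const _
  have hk : HasDerivAt (fun x : ℝ => m * x / ε) (m * 1 / ε) x :=
    ((hasDerivAt_id x).const_mul m).div_const _
  rw [hfun]
  refine (((ha.cosh.mul hk.cosh).const_mul (-m)).add
    ((ha.sinh.mul hk.sinh).const_mul (1 / 2))).deriv.trans ?_
  field_simp
  ring

theorem stmt_13 (L : ℝ) (hL : 0 < L) (lam : ℝ → ℝ)
    (hlam : ∀ ε : ℝ, ε ∈ Set.Ioo (0 : ℝ) (L / 4) →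
      (0 ≤ lam ε ∧ lam ε < 1 / (4 * ε)) ∧
      Real.sqrt (1 / 4 - ε * lam ε) =
        (1 / 2) * Real.tanh (L / (2 * ε)) *
          Real.tanh ((L / ε) * Real.sqrt (1 / 4 - ε * lam ε))) :
    Filter.Tendsto
      (fun ε : ℝ =>
        -2 * ε * deriv (fun x => Real.cosh (x / (2 * ε)) *
          (-(Real.sqrt (1 / 4 - ε * lam ε)) *
              Real.cosh (Real.sqrt (1 / 4 - ε * lam ε) * x / ε)
            + (1 / 2) * Real.tanh (x / (2 * ε)) *
                Real.sinh (Real.sqrt (1 / 4 - ε * lam ε) * x / ε))) (-L))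
      (nhdsWithin 0 (Set.Ioo (0 : ℝ) (L / 4))) (nhds 1) := by
  have hmem : ∀ᶠ ε in nhdsWithin 0 (Set.Ioo (0 : ℝ) (L / 4)), ε ∈ Set.Ioo (0 : ℝ) (L / 4) :=
    self_mem_nhdsWithin
  have hA : Tendsto (fun ε : ℝ => L / (2 * ε)) (nhdsWithin 0 (Set.Ioo (0 : ℝ) (L / 4))) atTop := by
    have := (tendsto_inv_nhdsGT_zero (𝕜 := ℝ)).mono_left
      (nhdsWithin_mono 0 (Set.Ioo_subset_Ioi_self : Set.Ioo (0 : ℝ) (L / 4) ⊆ Set.Ioi 0))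
    refine (this.const_mul_atTop (half_pos hL)).congr fun ε => ?_
    rw [← div_div, div_eq_mul_inv (L / 2)]
  have hlim := tendsto_cosh_mul_sinh_of_eq_mul_tanh (l := nhdsWithin 0 (Set.Ioo (0 : ℝ) (L / 4)))
    (y := fun ε => L / ε * √(1 / 4 - ε * lam ε)) hA ?_ ?_
  · have h2 := hlim.const_mul (1 / 2)
    norm_num only at h2
    refine h2.congr' ?_
    filter_upwards [hmem] with ε hε
    have hε0 : ε ≠ 0 := hε.1.ne'
    have heq := (hlam ε hε).2
    rw [deriv_cosh_mul_first_adjoint_eigenfunction hε0]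
    set m := √(1 / 4 - ε * lam ε)
    have e1 : Real.tanh (L / (2 * ε)) * Real.tanh (L / ε * m) = 2 * m := by linarith
    have e2 : m * -L / ε = -(L / ε * m) := by ring
    rw [e1, e2, neg_div, Real.cosh_neg, Real.sinh_neg]
    field_simp
    ring
  · filter_upwards [hmem] with ε hε
    have h := (hlam ε hε).1.2
    have hε0 := hε.1
    have : ε * lam ε < 1 / 4 := by
      rw [lt_div_iff₀ (by positivity)] at h
      linarith
    have := Real.sqrt_pos.2 (sub_pos.2 this)
    positivity
  · filter_upwards [hmem] with ε hε
    have hε0 : ε ≠ 0 := hε.1.ne'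
    have heq := (hlam ε hε).2
    calc L / ε * √(1 / 4 - ε * lam ε) = L / ε * (1 / 2 * Real.tanh (L / (2 * ε)) *
          Real.tanh (L / ε * √(1 / 4 - ε * lam ε))) := congrArg (L / ε * ·) heq
      _ = _ := by field_simp
end
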